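/- arXiv:1407.6671 — 2 statements merged into one kernel-verified Lean document; each statement's English description precedes it below -/
import Mathlib

section
/- Let X and Z be standard Borel spaces and let s : Z → X be a Borel surjection such that s⁻¹({x}) is countable for every x ∈ X. Then there is a countable partition (P_n)_{n∈ω} of Z into Borel subsets such that the restriction of s to each P_n is injective. -/
open Set MeasureTheory TopologicalSpace Filter Topology

/-- A family of sets is large if, after removing countably many Borel partial sections, some
fiber still meets every member of the family. -/
def LNLarge {Z X : Type*} [MeasurableSpace Z] (s : Z → X) (L : Set (Set Z)) : Prop :=
  ∀ F : Set (Set Z), F.Countable → (∀ P ∈ F, MeasurableSet P ∧ InjOn s P) →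
    ∃ x, ∀ U ∈ L, ∃ z ∈ U, z ∉ ⋃₀ F ∧ s z = x

theorem LNLarge.mono {Z X : Type*} [MeasurableSpace Z] {s : Z → X} {L L' : Set (Set Z)}
    (h : LNLarge s L) (hL : L' ⊆ L) : LNLarge s L' := by
  intro F hF hP
  obtain ⟨x, hx⟩ := h F hF hP
  exact ⟨x, fun U hU => hx U (hL hU)⟩

theorem ln_analytic_inter {Z : Type*} [TopologicalSpace Z] [T2Space Z] {A B : Set Z}
    (hA : AnalyticSet A) (hB : AnalyticSet B) : AnalyticSet (A ∩ B) := by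
  rw [inter_eq_iInter]
  apply AnalyticSet.iInter
  rintro (_ | _) <;> simpa

theorem ln_analytic_nbhd {Z X : Type*} [TopologicalSpace Z] [PolishSpace Z]
    [TopologicalSpace X] [T2Space X]
    {s : Z → X} (hs : Continuous s) {A : Set Z} (hA : AnalyticSet A) :
    AnalyticSet {y | ∃ z ∈ A, z ≠ y ∧ s z = s y} := by
  borelize Z
  have h1 : AnalyticSet {p : Z × Z | p.1 ≠ p.2} := by
    apply MeasurableSet.analyticSet
    exact (isClosed_eq continuous_fst continuous_snd).measurableSet.compl
  have h2 : AnalyticSet {p : Z × Z | s p.1 = s p.2} :=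
    (isClosed_eq (hs.comp continuous_fst) (hs.comp continuous_snd)).analyticSet
  have h3 : AnalyticSet ((Prod.fst : Z × Z → Z) ⁻¹' A) := hA.preimage continuous_fst
  have := (ln_analytic_inter h3 (ln_analytic_inter h1 h2)).image_of_continuous
    (continuous_snd : Continuous (Prod.snd : Z × Z → Z))
  convert this using 1
  ext y
  constructor
  · rintro ⟨z, hz, h, h'⟩
    exact ⟨(z, y), ⟨hz, h, h'⟩, rfl⟩
  · rintro ⟨⟨z, y'⟩, ⟨hz, h, h'⟩, rfl⟩
    exact ⟨z, hz, h, h'⟩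

theorem ln_borel_superset {Z X : Type*} [TopologicalSpace Z] [PolishSpace Z]
    [MeasurableSpace Z] [BorelSpace Z] [TopologicalSpace X] [T2Space X]
    {s : Z → X} (hs : Continuous s) {A : Set Z} (hA : AnalyticSet A) (hinj : InjOn s A) :
    ∃ B, MeasurableSet B ∧ A ⊆ B ∧ InjOn s B := by
  obtain ⟨B0, hAB0, hd0, hm0⟩ := hA.measurablySeparable (ln_analytic_nbhd hs hA) (by
    rw [Set.disjoint_left]
    rintro y hy ⟨z, hz, hne, h⟩
    exact hne (hinj hz hy h))
  obtain ⟨B1, hAB1, hd1, hm1⟩ := hA.measurablySeparable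
    (ln_analytic_nbhd hs hm0.analyticSet) (by
    rw [Set.disjoint_left]
    rintro y hy ⟨z, hz, hne, h⟩
    exact Set.disjoint_left.1 hd0 ⟨y, hy, hne.symm, h.symm⟩ hz)
  refine ⟨B0 ∩ B1, hm0.inter hm1, subset_inter hAB0 hAB1, ?_⟩
  intro y hy z hz h
  by_contra hne
  exact Set.disjoint_left.1 hd1 ⟨y, hy.1, hne, h⟩ hz.2

theorem ln_exists_basis {Z : Type*} [MetricSpace Z] [SecondCountableTopology Z]
    {U : Set Z} (hU : IsOpen U) {z : Z} (hz : z ∈ U) {ε : ENNReal} (hε : 0 < ε) :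
    ∃ W ∈ countableBasis Z, z ∈ W ∧ closure W ⊆ U ∧ Metric.ediam W ≤ ε := by
  have h2 : 0 < ε / 2 := ENNReal.half_pos hε.ne'
  have hn : U ∩ Metric.eball z (ε / 2) ∈ 𝓝 z :=
    inter_mem (hU.mem_nhds hz) (Metric.eball_mem_nhds z h2)
  obtain ⟨W, hW, hzW, hc⟩ := (isBasis_countableBasis Z).exists_closure_subset hn
  refine ⟨W, hW, hzW, hc.trans inter_subset_left, ?_⟩
  calc Metric.ediam W ≤ Metric.ediam (Metric.eball z (ε / 2)) :=
        Metric.ediam_mono (subset_closure.trans (hc.trans inter_subset_right))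
    _ ≤ 2 * (ε / 2) := Metric.ediam_eball_le
    _ = ε := ENNReal.mul_div_cancel (by simp) (by simp)

theorem ln_step {Z X : Type*} [MetricSpace Z] [CompleteSpace Z] [SecondCountableTopology Z]
    [MeasurableSpace Z] [BorelSpace Z] [TopologicalSpace X] [T2Space X]
    {s : Z → X} (hs : Continuous s) {L : Set (Set Z)} (hLc : L.Countable)
    (hLo : ∀ U ∈ L, IsOpen U) (hL : LNLarge s L) {U : Set Z} (hU : U ∈ L)
    {ε : ENNReal} (hε : 0 < ε) :
    ∃ W W' : Set Z, IsOpen W ∧ IsOpen W' ∧ closure W ⊆ U ∧ closure W' ⊆ U ∧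
      Metric.ediam W ≤ ε ∧ Metric.ediam W' ≤ ε ∧ Disjoint W W' ∧
      LNLarge s (insert W (insert W' L)) := by
  by_contra hcon
  let G : Set (Set Z × Set Z) := {p | p ∈ countableBasis Z ×ˢ countableBasis Z ∧
    closure p.1 ⊆ U ∧ closure p.2 ⊆ U ∧ Metric.ediam p.1 ≤ ε ∧ Metric.ediam p.2 ≤ ε ∧
    Disjoint p.1 p.2}
  have hG : G.Countable := ((countable_countableBasis Z).prod (countable_countableBasis Z)).mono
    fun p hp => hp.1
  have hnot : ∀ p : Set Z × Set Z, ∃ F : Set (Set Z), p ∈ G →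
      F.Countable ∧ (∀ P ∈ F, MeasurableSet P ∧ InjOn s P) ∧
      ¬ ∃ x, ∀ V ∈ insert p.1 (insert p.2 L), ∃ z ∈ V, z ∉ ⋃₀ F ∧ s z = x := by
    intro p
    by_cases hp : p ∈ G
    · by_contra hF
      refine hcon ⟨p.1, p.2, isOpen_of_mem_countableBasis hp.1.1,
        isOpen_of_mem_countableBasis hp.1.2, hp.2.1, hp.2.2.1, hp.2.2.2.1, hp.2.2.2.2.1,
        hp.2.2.2.2.2, ?_⟩
      intro F hF1 hF2
      by_contra h
      exact hF ⟨F, fun _ => ⟨hF1, hF2, h⟩⟩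
    · exact ⟨∅, fun h => absurd h hp⟩
  choose F hF using hnot
  let H : Set (Set Z) := ⋃ p ∈ G, F p
  have hHc : H.Countable := hG.biUnion fun p hp => (hF p hp).1
  have hHp : ∀ P ∈ H, MeasurableSet P ∧ InjOn s P := by
    intro P hP
    simp only [H, mem_iUnion] at hP
    obtain ⟨p, hp, hP⟩ := hP
    exact (hF p hp).2.1 P hP
  have hN : MeasurableSet (⋃₀ H) := MeasurableSet.sUnion hHc fun P hP => (hHp P hP).1
  have hLc' : Countable L := hLc.to_subtype
  have hLne : Nonempty L := ⟨⟨U, hU⟩⟩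
  let A : Set Z := (U \ ⋃₀ H) ∩ s ⁻¹' (⋂ V : L, s '' (V.1 \ ⋃₀ H))
  have hA : AnalyticSet A := by
    refine ln_analytic_inter ((hLo U hU).measurableSet.diff hN).analyticSet ?_
    refine AnalyticSet.preimage (AnalyticSet.iInter fun V => ?_) hs
    exact ((hLo V.1 V.2).measurableSet.diff hN).analyticSet.image_of_continuous hs
  have hinj : InjOn s A := by
    intro y hy z hz hyz
    by_contra hne
    obtain ⟨O, O', hO, hO', hyO, hzO, hOO⟩ := t2_separation hne
    obtain ⟨W, hWb, hyW, hWc, hWd⟩ := ln_exists_basis (hO.inter (hLo U hU)) ⟨hyO, hy.1.1⟩ hε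
    obtain ⟨W', hWb', hzW, hWc', hWd'⟩ := ln_exists_basis (hO'.inter (hLo U hU)) ⟨hzO, hz.1.1⟩ hε
    have hp : (W, W') ∈ G := ⟨⟨hWb, hWb'⟩, hWc.trans inter_subset_right,
      hWc'.trans inter_subset_right, hWd, hWd',
      hOO.mono (subset_closure.trans (hWc.trans inter_subset_left))
        (subset_closure.trans (hWc'.trans inter_subset_left))⟩
    have hsub : ⋃₀ F (W, W') ⊆ ⋃₀ H :=
      sUnion_subset_sUnion (subset_biUnion_of_mem (u := F) hp)
    refine (hF _ hp).2.2 ⟨s y, ?_⟩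
    rintro V (rfl | rfl | hV)
    · exact ⟨y, hyW, fun h => hy.1.2 (hsub h), rfl⟩
    · exact ⟨z, hzW, fun h => hz.1.2 (hsub h), hyz.symm⟩
    · obtain ⟨w, hw, hws⟩ := mem_iInter.1 hy.2 ⟨V, hV⟩
      exact ⟨w, hw.1, fun h => hw.2 (hsub h), hws⟩
  obtain ⟨B, hB, hAB, hBinj⟩ := ln_borel_superset hs hA hinj
  obtain ⟨x, hx⟩ := hL (insert B H) (hHc.insert B) (by
    rintro P (rfl | hP)
    · exact ⟨hB, hBinj⟩
    · exact hHp P hP)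
  have hsub : ⋃₀ H ⊆ ⋃₀ (insert B H) := sUnion_subset_sUnion (subset_insert _ _)
  obtain ⟨z, hzU, hzN, hzx⟩ := hx U hU
  refine hzN ⟨B, mem_insert _ _, hAB ⟨⟨hzU, fun h => hzN (hsub h)⟩, ?_⟩⟩
  refine mem_iInter.2 fun V => ?_
  obtain ⟨w, hw, hwN, hwx⟩ := hx V.1 V.2
  exact ⟨w, ⟨hw, fun h => hwN (hsub h)⟩, hwx.trans hzx.symm⟩

theorem ln_level {Z X : Type*} [MetricSpace Z] [CompleteSpace Z] [SecondCountableTopology Z]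
    [MeasurableSpace Z] [BorelSpace Z] [TopologicalSpace X] [T2Space X]
    {s : Z → X} (hs : Continuous s) {ε : ENNReal} (hε : 0 < ε) (n : ℕ)
    (U : List Bool → Set Z) (hUo : ∀ l, l.length = n → IsOpen (U l))
    (hU : LNLarge s (U '' {l | l.length = n})) :
    ∃ U' : List Bool → Set Z, ((∀ l, l.length = n + 1 → IsOpen (U' l)) ∧
      LNLarge s (U' '' {l | l.length = n + 1})) ∧
      ∀ l : List Bool, l.length = n →
        (∀ b, closure (U' (b :: l)) ⊆ U l ∧ Metric.ediam (U' (b :: l)) ≤ ε) ∧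
        Disjoint (U' (true :: l)) (U' (false :: l)) := by
  classical
  have hfin : {l : List Bool | l.length = n}.Finite := List.finite_length_eq Bool n
  have key : ∀ S : Finset (List Bool), (∀ l ∈ S, l.length = n) →
      ∃ W : List Bool → Bool → Set Z,
        (∀ l ∈ S, (∀ b, IsOpen (W l b) ∧ closure (W l b) ⊆ U l ∧ Metric.ediam (W l b) ≤ ε) ∧
          Disjoint (W l true) (W l false)) ∧
        LNLarge s (U '' {l | l.length = n} ∪ ⋃ l ∈ S, range (W l)) := by
    intro S
    induction S using Finset.induction_on with
    | empty => intro _; exact ⟨fun _ _ => ∅, by simp, by simpa using hU⟩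
    | insert a S ha ih =>
      intro hS
      obtain ⟨W, hW, hWL⟩ := ih fun l hl => hS l (Finset.mem_insert_of_mem hl)
      have hc : (U '' {l | l.length = n} ∪ ⋃ l ∈ S, range (W l)).Countable :=
        (hfin.image U).countable.union
          (S.countable_toSet.biUnion fun l _ => countable_range _)
      obtain ⟨V, V', hV, hV', hcV, hcV', hdV, hdV', hdis, hlarge⟩ := ln_step hs hc (by
        rintro O (⟨l, hl, rfl⟩ | hO)
        · exact hUo l hl
        · simp only [mem_iUnion] at hO
          obtain ⟨l, hl, b, rfl⟩ := hO
          exact ((hW l hl).1 b).1) hWL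
        (Or.inl ⟨a, hS a (Finset.mem_insert_self _ _), rfl⟩) hε
      have hne : ∀ l ∈ S, l ≠ a := fun l hl h => ha (h ▸ hl)
      refine ⟨Function.update W a fun b => if b then V else V', ?_, ?_⟩
      · intro l hl
        rcases Finset.mem_insert.1 hl with rfl | hl
        · simp only [Function.update_self]
          refine ⟨?_, by simpa using hdis⟩
          rintro (_ | _)
          · simp [hV', hcV', hdV']
          · simp [hV, hcV, hdV]
        · rw [Function.update_of_ne (hne l hl)]
          exact hW l hl
      · refine hlarge.mono ?_
        rintro O (hO | hO)
        · exact Or.inr (Or.inr (Or.inl hO))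
        · simp only [mem_iUnion] at hO
          obtain ⟨l, hl, b, rfl⟩ := hO
          rcases Finset.mem_insert.1 hl with rfl | hl
          · simp only [Function.update_self]
            cases b <;> simp
          · rw [Function.update_of_ne (hne l hl)]
            refine Or.inr (Or.inr (Or.inr ?_))
            simp only [mem_iUnion]
            exact ⟨l, hl, b, rfl⟩
  obtain ⟨W, hW, hL⟩ := key hfin.toFinset (by simp)
  simp only [Set.Finite.mem_toFinset, mem_ofPred] at hW hL
  refine ⟨fun l => match l with | [] => ∅ | b :: l => W l b, ⟨?_, ?_⟩, ?_⟩
  · rintro (_ | ⟨b, l⟩) hl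
    · simp at hl
    · exact ((hW l (by simpa using hl)).1 b).1
  · refine hL.mono ?_
    rintro O ⟨_ | ⟨b, l⟩, hl, rfl⟩
    · simp at hl
    · refine Or.inr ?_
      simp only [mem_iUnion]
      exact ⟨l, by simpa using hl, b, rfl⟩
  · intro l hl
    exact ⟨fun b => ((hW l hl).1 b).2, (hW l hl).2⟩

theorem ln_main {Z X : Type*} [MetricSpace Z] [CompleteSpace Z] [SecondCountableTopology Z]
    [MeasurableSpace Z] [BorelSpace Z] [TopologicalSpace X] [T2Space X]
    {s : Z → X} (hs : Continuous s) (hcount : ∀ x : X, (s ⁻¹' {x}).Countable) :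
    ¬ LNLarge s {univ} := by
  intro hlarge
  let Q : ℕ → (List Bool → Set Z) → Prop := fun n U =>
    (∀ l, l.length = n → IsOpen (U l)) ∧ LNLarge s (U '' {l | l.length = n})
  have hεpos : ∀ n : ℕ, (0 : ENNReal) < ((n : ENNReal) + 1)⁻¹ := fun n => by simp
  have h0 : Q 0 fun _ => univ := by
    refine ⟨fun _ _ => isOpen_univ, hlarge.mono ?_⟩
    rintro O ⟨l, _, rfl⟩
    rfl
  have hstep : ∀ (n : ℕ) (U : {U // Q n U}), ∃ U' : {U // Q (n + 1) U},
      ∀ l : List Bool, l.length = n →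
        (∀ b, closure (U'.1 (b :: l)) ⊆ U.1 l ∧
          Metric.ediam (U'.1 (b :: l)) ≤ ((n : ENNReal) + 1)⁻¹) ∧
        Disjoint (U'.1 (true :: l)) (U'.1 (false :: l)) := by
    rintro n ⟨U, hU⟩
    obtain ⟨U', h1, h2⟩ := ln_level hs (hεpos n) n U hU.1 hU.2
    exact ⟨⟨U', h1⟩, h2⟩
  choose f hf using hstep
  let T : (n : ℕ) → {U // Q n U} := fun n => Nat.rec ⟨_, h0⟩ (fun n U => f n U) n
  have hT : ∀ n, T (n + 1) = f n (T n) := fun n => rfl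
  let A : List Bool → Set Z := fun l => (T l.length).1 l
  have hA : ∀ l : List Bool, (∀ b, closure (A (b :: l)) ⊆ A l ∧
      Metric.ediam (A (b :: l)) ≤ ((l.length : ENNReal) + 1)⁻¹) ∧
      Disjoint (A (true :: l)) (A (false :: l)) := by
    intro l
    have := hf l.length (T l.length) l rfl
    rw [← hT] at this
    exact this
  have hx : ∀ n, ∃ x, ∀ l : List Bool, l.length = n → ∃ z ∈ A l, s z = x := by
    intro n
    obtain ⟨x, hx⟩ := (T n).2.2 ∅ countable_empty (by simp)
    refine ⟨x, fun l hl => ?_⟩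
    obtain ⟨z, hz, -, hzx⟩ := hx _ ⟨l, hl, rfl⟩
    subst hl
    exact ⟨z, hz, hzx⟩
  choose x hx using hx
  have hanti : CantorScheme.ClosureAntitone A := fun l b => ((hA l).1 b).1
  have hdis : CantorScheme.Disjoint A := by
    rintro l (_ | _) (_ | _) hne
    · exact absurd rfl hne
    · exact (hA l).2.symm
    · exact (hA l).2
    · exact absurd rfl hne
  have hdiam : CantorScheme.VanishingDiam A := by
    intro α
    rw [← tendsto_add_atTop_iff_nat 1]
    have hlim : Tendsto (fun n : ℕ => ((n : ENNReal) + 1)⁻¹) atTop (𝓝 0) := by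
      have := (tendsto_add_atTop_iff_nat 1).2 ENNReal.tendsto_inv_nat_nhds_zero
      simpa using this
    refine tendsto_of_tendsto_of_tendsto_of_le_of_le tendsto_const_nhds hlim
      (fun _ => zero_le) fun n => ?_
    have := ((hA (PiNat.res α n)).1 (α n)).2
    rw [PiNat.res_length] at this
    exact this
  have hne : ∀ l, (A l).Nonempty := fun l => by
    obtain ⟨z, hz, -⟩ := hx _ l rfl
    exact ⟨z, hz⟩
  have hdom := hanti.map_of_vanishingDiam hdiam hne
  let φ : (ℕ → Bool) → Z := fun α => (CantorScheme.inducedMap A).2 ⟨α, hdom ▸ mem_univ α⟩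
  have hφ : Function.Injective φ := fun α β h => by
    have := hdis.map_injective h
    exact congrArg Subtype.val this
  have hmem : ∀ α n, φ α ∈ A (PiNat.res α n) := fun α n => CantorScheme.map_mem _ n
  have hlim : ∀ α, Tendsto x atTop (𝓝 (s (φ α))) := by
    intro α
    choose z hz hzx using fun n => hx n (PiNat.res α n) (PiNat.res_length α n)
    have hzlim : Tendsto z atTop (𝓝 (φ α)) := by
      rw [tendsto_iff_edist_tendsto_0]
      refine tendsto_of_tendsto_of_tendsto_of_le_of_le tendsto_const_nhds (hdiam α)
        (fun _ => zero_le) fun n => ?_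
      exact Metric.edist_le_ediam_of_mem (hz n) (hmem α n)
    have := (hs.tendsto (φ α)).comp hzlim
    exact this.congr hzx
  let o : ℕ → Bool := fun _ => false
  have hsub : ∀ α, φ α ∈ s ⁻¹' {s (φ o)} := fun α => tendsto_nhds_unique (hlim α) (hlim o)
  have hc : Countable (s ⁻¹' {s (φ o)}) := (hcount _).to_subtype
  have : Countable (ℕ → Bool) :=
    Function.Injective.countable (f := fun α => (⟨φ α, hsub α⟩ : s ⁻¹' {s (φ o)}))
      fun α β h => hφ (congrArg Subtype.val h)
  obtain ⟨g, hg⟩ := exists_surjective_nat (ℕ → Bool)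
  obtain ⟨k, hk⟩ := hg fun n => !(g n n)
  have := congrFun hk k
  simp at this

/-- Lusin–Novikov: if `s : Z → X` is a Borel countable-to-one surjection between
standard Borel spaces, then `Z` admits a countable Borel partition on each piece of
which `s` is injective. -/
theorem countable_partition_injOn_of_countable_to_one {Z X : Type*}
    [MeasurableSpace Z] [StandardBorelSpace Z] [MeasurableSpace X] [StandardBorelSpace X]
    (s : Z → X) (hs : Measurable s) (hsurj : Function.Surjective s)
    (hcount : ∀ x : X, (s ⁻¹' {x}).Countable) :
    ∃ P : ℕ → Set Z, (∀ n, MeasurableSet (P n)) ∧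
      Pairwise (Function.onFun Disjoint P) ∧
      (⋃ n, P n) = Set.univ ∧
      ∀ n, Set.InjOn s (P n) := by
  have hnot : ¬ LNLarge s {univ} := by
    obtain ⟨t, hB, hP⟩ := StandardBorelSpace.polish (α := Z)
    let := upgradeStandardBorel X
    obtain ⟨t', hle, hcont, hpol⟩ := hs.exists_continuous
    have hb : @BorelSpace Z t' _ := by
      refine @BorelSpace.mk Z t' _ ?_
      rw [borel_eq_borel_of_le hpol hP hle]
      exact hB.measurable_eq
    clear hle hB hP
    clear t
    let := t'
    let := upgradeIsCompletelyMetrizable Z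
    exact ln_main hcont hcount
  unfold LNLarge at hnot
  push Not at hnot
  obtain ⟨F, hFc, hF, hx⟩ := hnot
  obtain ⟨P, hP⟩ := (hFc.insert ∅).exists_eq_range (insert_nonempty _ _)
  have hPF : ∀ n, MeasurableSet (P n) ∧ InjOn s (P n) := by
    intro n
    have : P n ∈ insert ∅ F := hP ▸ mem_range_self n
    rcases this with h | h
    · rw [h]; simp
    · exact hF _ h
  refine ⟨disjointed P, fun n => MeasurableSet.disjointed (fun i => (hPF i).1) n,
    disjoint_disjointed P, ?_, fun n => (hPF n).2.mono (disjointed_subset P n)⟩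
  rw [iUnion_disjointed, eq_univ_iff_forall]
  intro z
  by_contra hz
  obtain ⟨U, hU, h⟩ := hx (s z)
  rw [mem_singleton_iff] at hU
  subst hU
  refine h z (mem_univ z) ?_ rfl
  rintro ⟨p, hp, hzp⟩
  have : p ∈ range P := hP ▸ mem_insert_of_mem _ hp
  obtain ⟨n, rfl⟩ := this
  exact hz (mem_iUnion.2 ⟨n, hzp⟩)
end

section
/- Let X and Z be standard Borel spaces and let s : Z → X be a Borel countable-to-one map. Then for every n ∈ ℕ the set {x ∈ X : the fiber s⁻¹({x}) has exactly n elements} is a Borel subset of X. -/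
open Set Filter Topology MeasureTheory

namespace FiberCard

/-- An analytic set (image of a Borel set) on which `s` is injective is contained in a Borel set
on which `s` is injective. -/
lemma nbr_analytic {Z X W : Type*} [TopologicalSpace Z] [PolishSpace Z] [MeasurableSpace Z]
    [BorelSpace Z] [MeasurableSpace X] [StandardBorelSpace X]
    [MeasurableSpace W] [StandardBorelSpace W] {s : Z → X} (hs : Measurable s)
    {f : W → Z} (hf : Measurable f) {H : Set W} (hH : MeasurableSet H) :
    AnalyticSet {z : Z | ∃ w ∈ H, s (f w) = s z ∧ f w ≠ z} := by
  have hM : MeasurableSet {p : W × Z | p.1 ∈ H ∧ s (f p.1) = s p.2 ∧ f p.1 ≠ p.2} := by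
    refine (measurable_fst hH).inter (MeasurableSet.inter ?_ ?_)
    · exact measurableSet_eq_fun (hs.comp (hf.comp measurable_fst)) (hs.comp measurable_snd)
    · exact (measurableSet_eq_fun (hf.comp measurable_fst) measurable_snd).compl
  have := hM.analyticSet_image (f := (Prod.snd : W × Z → Z)) measurable_snd
  convert this using 1
  ext z
  simp

lemma exists_borel_injOn {Z X W : Type*} [TopologicalSpace Z] [PolishSpace Z] [MeasurableSpace Z]
    [BorelSpace Z] [MeasurableSpace X] [StandardBorelSpace X]
    [MeasurableSpace W] [StandardBorelSpace W] {s : Z → X} (hs : Measurable s)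
    {f : W → Z} (hf : Measurable f) {H : Set W} (hH : MeasurableSet H)
    (hinj : InjOn s (f '' H)) :
    ∃ B, MeasurableSet B ∧ InjOn s B ∧ f '' H ⊆ B := by
  have hA : AnalyticSet (f '' H) := hH.analyticSet_image hf
  obtain ⟨B0, h0, hd0, hm0⟩ := hA.measurablySeparable (nbr_analytic hs hf hH) (by
    rw [Set.disjoint_left]
    rintro z hz ⟨w, hw, h1, h2⟩
    exact h2 (hinj ⟨w, hw, rfl⟩ hz h1))
  obtain ⟨B1, h1, hd1, hm1⟩ := hA.measurablySeparable (nbr_analytic hs measurable_id hm0) (by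
    rw [Set.disjoint_left]
    rintro _ ⟨w, hw, rfl⟩ ⟨z, hz, e1, e2⟩
    exact Set.disjoint_left.1 hd0 ⟨w, hw, e1.symm, fun h => e2 h.symm⟩ hz)
  refine ⟨B0 ∩ B1, hm0.inter hm1, ?_, subset_inter h0 h1⟩
  intro a ha b hb hab
  by_contra hne
  exact Set.disjoint_left.1 hd1 ⟨a, ha.1, hab, hne⟩ hb.2

/-- A sequence of closed sets such that, off any countable union of Borel sets on which `s` is
injective, one can pick points in all of them in a common fiber. -/
def Good {Z X : Type*} [TopologicalSpace Z] [MeasurableSpace Z] (s : Z → X)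
    (V : ℕ → Set Z) : Prop :=
  (∀ i, IsClosed (V i)) ∧ ∀ B : ℕ → Set Z, (∀ k, MeasurableSet (B k) ∧ InjOn s (B k)) →
    ∃ h : ℕ → Z, (∀ i, h i ∈ V i) ∧ (∀ i k, h i ∉ B k) ∧ ∀ i, s (h i) = s (h 0)

lemma Good.split {Z X : Type*} [MetricSpace Z] [CompleteSpace Z] [SecondCountableTopology Z]
    [MeasurableSpace Z]
    [BorelSpace Z] [MeasurableSpace X] [StandardBorelSpace X] {s : Z → X} (hs : Measurable s)
    {V : ℕ → Set Z} (hV : Good s V) {i j : ℕ} (hij : i ≠ j) {ε : ℝ} (hε : 0 < ε) :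
    ∃ W0 W1 : Set Z, W0 ⊆ V i ∧ W1 ⊆ V i ∧ Disjoint W0 W1 ∧
      (∀ p ∈ W0, ∀ q ∈ W0, dist p q ≤ ε) ∧
      Good s (Function.update (Function.update V i W0) j W1) := by
  have : Nonempty Z := by
    obtain ⟨h, -⟩ := hV.2 (fun _ => ∅) (by simp)
    exact ⟨h 0⟩
  let C : ℕ × ℕ → Set Z := fun k =>
    Metric.closedBall (TopologicalSpace.denseSeq Z k.1) (1 / ((k.2 : ℝ) + 1))
  have hC : ∀ z : Z, ∀ δ > 0, ∃ k, z ∈ C k ∧ ∀ p ∈ C k, ∀ q ∈ C k, dist p q ≤ δ := by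
    intro z δ hδ
    obtain ⟨m, hm⟩ := exists_nat_one_div_lt (half_pos hδ)
    obtain ⟨k, hk⟩ := (TopologicalSpace.denseRange_denseSeq Z).exists_dist_lt z
      (ε := 1 / ((m : ℝ) + 1)) (by positivity)
    refine ⟨(k, m), hk.le, fun p hp q hq => ?_⟩
    have hp' : dist p (TopologicalSpace.denseSeq Z k) ≤ 1 / ((m : ℝ) + 1) := hp
    have hq' : dist q (TopologicalSpace.denseSeq Z k) ≤ 1 / ((m : ℝ) + 1) := hq
    have := dist_triangle_right p q (TopologicalSpace.denseSeq Z k)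
    linarith
  by_contra hcon
  push Not at hcon
  let U : (ℕ × ℕ) × (ℕ × ℕ) → ℕ → Set Z := fun b =>
    Function.update (Function.update V i (V i ∩ C b.1)) j (V i ∩ C b.2)
  have hUc : ∀ b l, IsClosed (U b l) := by
    intro b l
    have hc : ∀ k, IsClosed (V i ∩ C k) := fun k => (hV.1 i).inter Metric.isClosed_closedBall
    simp only [U, Function.update_apply]
    split_ifs
    exacts [hc _, hc _, hV.1 l]
  have key : ∀ b : (ℕ × ℕ) × (ℕ × ℕ), ∃ B : ℕ → Set Z,
      (∀ k, MeasurableSet (B k) ∧ InjOn s (B k)) ∧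
      (Disjoint (C b.1) (C b.2) → (∀ p ∈ C b.1, ∀ q ∈ C b.1, dist p q ≤ ε) →
        ¬ ∃ h : ℕ → Z, (∀ l, h l ∈ U b l) ∧ (∀ l k, h l ∉ B k) ∧ ∀ l, s (h l) = s (h 0)) := by
    intro b
    by_cases hb : Disjoint (C b.1) (C b.2) ∧ (∀ p ∈ C b.1, ∀ q ∈ C b.1, dist p q ≤ ε)
    · have := hcon (V i ∩ C b.1) (V i ∩ C b.2) inter_subset_left inter_subset_left
        (hb.1.mono inter_subset_right inter_subset_right)
        (fun p hp q hq => hb.2 p hp.2 q hq.2)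
      by_contra hno
      apply this
      refine ⟨hUc b, fun B hB => ?_⟩
      by_contra hh
      exact hno ⟨B, hB, fun _ _ => hh⟩
    · exact ⟨fun _ => ∅, by simp, fun h1 h2 => absurd ⟨h1, h2⟩ hb⟩
  choose B hB hBno using key
  obtain ⟨e, he⟩ := exists_surjective_nat (((ℕ × ℕ) × (ℕ × ℕ)) × ℕ)
  let H : Set (ℕ → Z) := {h | (∀ l, h l ∈ V l) ∧ (∀ l k, h l ∉ B (e k).1 (e k).2) ∧
    ∀ l, s (h l) = s (h 0)}
  have hH : MeasurableSet H := by
    simp only [H, ofPred_and, ofPred_forall]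
    refine (MeasurableSet.iInter fun l => ?_).inter ((MeasurableSet.iInter fun l =>
      MeasurableSet.iInter fun k => ?_).inter (MeasurableSet.iInter fun l => ?_))
    · exact measurable_pi_apply l (hV.1 l).measurableSet
    · exact (measurable_pi_apply l (hB (e k).1 (e k).2).1).compl
    · exact measurableSet_eq_fun (hs.comp (measurable_pi_apply l)) (hs.comp (measurable_pi_apply 0))
  have hinj : InjOn s ((fun h : ℕ → Z => h i) '' H) := by
    rintro _ ⟨h, hh, rfl⟩ _ ⟨h', hh', rfl⟩ heq
    by_contra hne
    simp only at hne heq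
    have hd : 0 < dist (h i) (h' i) := dist_pos.2 hne
    obtain ⟨k0, hk0, hs0⟩ := hC (h i) (min ε (dist (h i) (h' i) / 3)) (by positivity)
    obtain ⟨k1, hk1, hs1⟩ := hC (h' i) (dist (h i) (h' i) / 3) (by positivity)
    refine hBno (k0, k1) ?_ ?_ ⟨Function.update h j (h' i), ?_, ?_, ?_⟩
    · rw [Set.disjoint_left]
      intro p hp0 hp1
      have a1 := (hs0 _ hk0 p hp0).trans (min_le_right _ _)
      have a2 := hs1 p hp1 _ hk1
      have := dist_triangle (h i) p (h' i)
      linarith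
    · exact fun p hp q hq => (hs0 p hp q hq).trans (min_le_left _ _)
    · intro l
      by_cases hl : l = j
      · subst hl
        simpa [U] using ⟨hh'.1 i, hk1⟩
      · by_cases hl' : l = i
        · subst hl'
          simpa [U, hl] using ⟨hh.1 l, hk0⟩
        · simpa [U, hl, hl'] using hh.1 l
    · intro l k
      obtain ⟨m, hm⟩ := he ((k0, k1), k)
      have b1 := hh.2.1 l m
      have b2 := hh'.2.1 i m
      rw [hm] at b1 b2
      by_cases hl : l = j
      · subst hl
        simpa using b2
      · simpa [hl] using b1
    · have h0 : ∀ l, s (Function.update h j (h' i) l) = s (h 0) := by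
        intro l
        by_cases hl : l = j
        · subst hl
          simpa [← heq] using hh.2.2 i
        · simpa [hl] using hh.2.2 l
      intro l
      rw [h0, h0]
  obtain ⟨D, hDm, hDi, hDs⟩ := exists_borel_injOn hs (measurable_pi_apply i) hH hinj
  obtain ⟨h, h1, h2, h3⟩ := hV.2 (fun k => Nat.casesOn k D fun k => B (e k).1 (e k).2) (by
    rintro (_ | k)
    · exact ⟨hDm, hDi⟩
    · exact hB _ _)
  exact h2 i 0 (hDs ⟨h, ⟨h1, fun l k => h2 l (k + 1), h3⟩, rfl⟩)

lemma not_good_univ {Z X : Type*} [MetricSpace Z] [CompleteSpace Z] [SecondCountableTopology Z]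
    [MeasurableSpace Z] [BorelSpace Z] [TopologicalSpace X] [T2Space X] [MeasurableSpace X]
    [BorelSpace X] [StandardBorelSpace X] {s : Z → X} (hs : Continuous s)
    (hcount : ∀ x : X, (s ⁻¹' {x}).Countable) : ¬ Good s (fun _ => univ) := by
  intro hgood
  have step : ∀ (n : ℕ) (V : {V : ℕ → Set Z // Good s V}), ∃ V' : {V : ℕ → Set Z // Good s V},
      V'.1 (n.unpair.1) ⊆ V.1 (n.unpair.1) ∧ V'.1 (n + 1) ⊆ V.1 (n.unpair.1) ∧
      Disjoint (V'.1 (n.unpair.1)) (V'.1 (n + 1)) ∧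
      (∀ p ∈ V'.1 (n.unpair.1), ∀ q ∈ V'.1 (n.unpair.1), dist p q ≤ 1 / ((n : ℝ) + 1)) ∧
      ∀ l, l ≠ n.unpair.1 → l ≠ n + 1 → V'.1 l = V.1 l := by
    intro n V
    have hne : n.unpair.1 ≠ n + 1 := by
      have := Nat.unpair_left_le n
      omega
    obtain ⟨W0, W1, h0, h1, hd, hdi, hg⟩ := V.2.split hs.measurable hne
      (ε := 1 / ((n : ℝ) + 1)) (by positivity)
    refine ⟨⟨_, hg⟩, ?_, ?_, ?_, ?_, ?_⟩
    · simpa [hne] using h0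
    · simpa [hne] using h1
    · simpa [hne] using hd
    · simpa [hne] using hdi
    · intro l hl hl'
      simp [hl, hl']
  choose F hF using step
  let G : ℕ → {V : ℕ → Set Z // Good s V} := fun n =>
    Nat.rec ⟨fun _ => univ, hgood⟩ (fun n V => F n V) n
  have hG : ∀ n, G (n + 1) = F n (G n) := fun n => rfl
  let V : ℕ → ℕ → Set Z := fun n => (G n).1
  have huniv : ∀ n l, n < l → V n l = univ := by
    intro n
    induction n with
    | zero => intro l _; rfl
    | succ n ih =>
      intro l hl
      have := (hF n (G n)).2.2.2.2 l (by have := Nat.unpair_left_le n; omega) (by omega)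
      exact this.trans (ih l (by omega))
  have hstep : ∀ n l, V (n + 1) l ⊆ V n l := by
    intro n l
    by_cases h1 : l = n.unpair.1
    · subst h1; exact (hF n (G n)).1
    · by_cases h2 : l = n + 1
      · subst h2; rw [huniv n (n + 1) (by omega)]; exact subset_univ _
      · exact ((hF n (G n)).2.2.2.2 l h1 h2).subset
  have hanti : ∀ l, Antitone (fun n => V n l) := fun l => antitone_nat_of_succ_le fun n => hstep n l
  have hsplit : ∀ i k, let n := Nat.pair i k; V (n + 1) (n + 1) ⊆ V n i ∧
      Disjoint (V (n + 1) i) (V (n + 1) (n + 1)) ∧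
      ∀ p ∈ V (n + 1) i, ∀ q ∈ V (n + 1) i, dist p q ≤ 1 / ((n : ℝ) + 1) := by
    intro i k n
    have hn : n.unpair.1 = i := by simp [n]
    have := hF n (G n)
    rw [hn] at this
    exact ⟨this.2.1, this.2.2.1, this.2.2.2.1⟩
  have hsmall : ∀ i, ∀ ε > 0, ∃ N, ∀ p ∈ V N i, ∀ q ∈ V N i, dist p q < ε := by
    intro i ε hε
    obtain ⟨k, hk⟩ := exists_nat_one_div_lt hε
    refine ⟨Nat.pair i k + 1, fun p hp q hq => ((hsplit i k).2.2 p hp q hq).trans_lt ?_⟩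
    refine lt_of_le_of_lt ?_ hk
    have : (k : ℝ) ≤ (Nat.pair i k : ℝ) := by exact_mod_cast Nat.right_le_pair i k
    gcongr
  have hex : ∀ n, ∃ h : ℕ → Z, (∀ i, h i ∈ V n i) ∧ ∀ i, s (h i) = s (h 0) := by
    intro n
    obtain ⟨h, h1, -, h3⟩ := (G n).2.2 (fun _ => ∅) (by simp)
    exact ⟨h, h1, h3⟩
  choose h hhV hhs using hex
  have hcau : ∀ i, CauchySeq (fun n => h n i) := by
    intro i
    rw [Metric.cauchySeq_iff]
    intro ε hε
    obtain ⟨N, hN⟩ := hsmall i ε hε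
    exact ⟨N, fun m hm n hn => hN _ (hanti i hm (hhV m i)) _ (hanti i hn (hhV n i))⟩
  choose z hz using fun i => cauchySeq_tendsto_of_complete (hcau i)
  have hzV : ∀ n i, z i ∈ V n i := by
    intro n i
    refine ((G n).2.1 i).mem_of_tendsto (hz i) ?_
    filter_upwards [eventually_ge_atTop n] with m hm
    exact hanti i hm (hhV m i)
  have hsz : ∀ i, s (z i) = s (z 0) := by
    intro i
    have h1 := (hs.tendsto _).comp (hz i)
    have h2 := (hs.tendsto _).comp (hz 0)
    refine tendsto_nhds_unique h1 (h2.congr fun n => ?_)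
    exact (hhs n i).symm
  have hpre : Preperfect (range z) := by
    rw [preperfect_iff_nhds]
    rintro _ ⟨i, rfl⟩ U hU
    obtain ⟨ε, hε, hεU⟩ := Metric.mem_nhds_iff.1 hU
    obtain ⟨N, hN⟩ := hsmall i ε hε
    have hle : N ≤ Nat.pair i N := Nat.right_le_pair i N
    obtain ⟨a1, a2, -⟩ := hsplit i N
    refine ⟨z (Nat.pair i N + 1), ⟨hεU ?_, mem_range_self _⟩, ?_⟩
    · exact hN _ (hanti i hle (a1 (hzV (Nat.pair i N + 1) (Nat.pair i N + 1)))) _ (hzV N i)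
    · intro heq
      have b := hzV (Nat.pair i N + 1) (Nat.pair i N + 1)
      rw [heq] at b
      exact Set.disjoint_left.1 a2 (hzV (Nat.pair i N + 1) i) b
  obtain ⟨f, hf, -, hfi⟩ := hpre.perfect_closure.exists_nat_bool_injection
    ⟨z 0, subset_closure (mem_range_self 0)⟩
  have hsub : closure (range z) ⊆ s ⁻¹' {s (z 0)} := by
    refine closure_minimal ?_ (isClosed_singleton.preimage hs)
    rintro _ ⟨i, rfl⟩
    exact hsz i
  have hc : (range f).Countable := (hcount _).mono (hf.trans hsub)
  have : Countable (ℕ → Bool) := by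
    have := hc.to_subtype
    exact (rangeFactorization_injective.2 hfi).countable
  have hle := Cardinal.mk_le_aleph0 (α := ℕ → Bool)
  have hlt := Cardinal.cantor Cardinal.aleph0
  simp only [Cardinal.mk_pi, Cardinal.mk_bool, Cardinal.prod_const, Cardinal.mk_nat,
    Cardinal.lift_id] at hle
  simp at hle hlt
  exact absurd hle (not_le.2 hlt)

/-- **Lusin–Novikov**: the range of a countable-to-one Borel map is Borel. -/
lemma measurableSet_range {Z X : Type*}
    [MeasurableSpace Z] [StandardBorelSpace Z] [MeasurableSpace X] [StandardBorelSpace X]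
    (s : Z → X) (hs : Measurable s)
    (hcount : ∀ x : X, (s ⁻¹' {x}).Countable) : MeasurableSet (range s) := by
  obtain ⟨tX, hbX, hpX⟩ := StandardBorelSpace.polish (α := X)
  have : ∃ t : TopologicalSpace Z, @BorelSpace Z t _ ∧ @PolishSpace Z t ∧
      @Continuous Z X t tX s := by
    obtain ⟨tZ, hbZ, hpZ⟩ := StandardBorelSpace.polish (α := Z)
    obtain ⟨t', hle, hc, hp⟩ := hs.exists_continuous
    refine ⟨t', ⟨?_⟩, hp, hc⟩
    rw [borel_eq_borel_of_le hp hpZ hle]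
    exact hbZ.measurable_eq
  obtain ⟨t, hb, hp, hc⟩ := this
  let := TopologicalSpace.upgradeIsCompletelyMetrizable Z
  have hng := not_good_univ hc hcount
  have : ∃ B : ℕ → Set Z, (∀ k, MeasurableSet (B k) ∧ InjOn s (B k)) ∧ ⋃ k, B k = univ := by
    by_contra hno
    apply hng
    refine ⟨fun _ => isClosed_univ, fun B hB => ?_⟩
    have : ⋃ k, B k ≠ univ := fun h => hno ⟨B, hB, h⟩
    obtain ⟨z, hz⟩ := (ne_univ_iff_exists_notMem _).1 this
    exact ⟨fun _ => z, fun _ => mem_univ _, fun _ k hk => hz (mem_iUnion.2 ⟨k, hk⟩), fun _ => rfl⟩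
  obtain ⟨B, hB, hU⟩ := this
  rw [← image_univ, ← hU, image_iUnion]
  exact MeasurableSet.iUnion fun k => (hB k).1.image_of_measurable_injOn hs (hB k).2

lemma measurableSet_le {Z X : Type*}
    [MeasurableSpace Z] [StandardBorelSpace Z] [MeasurableSpace X] [StandardBorelSpace X]
    (s : Z → X) (hs : Measurable s)
    (hcount : ∀ x : X, (s ⁻¹' {x}).Countable) (n : ℕ) :
    MeasurableSet {x : X | (n : ℕ∞) ≤ (s ⁻¹' {x}).encard} := by
  rcases n with _ | n
  · simp
  let T : Set (Fin (n + 1) → Z) := {h | (∀ i j, i ≠ j → h i ≠ h j) ∧ ∀ i, s (h i) = s (h 0)}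
  have hT : MeasurableSet T := by
    simp only [T, ofPred_and, ofPred_forall]
    refine (MeasurableSet.iInter fun i => MeasurableSet.iInter fun j =>
      MeasurableSet.iInter fun _ => ?_).inter (MeasurableSet.iInter fun i => ?_)
    · exact (measurableSet_eq_fun (measurable_pi_apply i) (measurable_pi_apply j)).compl
    · exact measurableSet_eq_fun (hs.comp (measurable_pi_apply i)) (hs.comp (measurable_pi_apply 0))
  have : StandardBorelSpace T := hT.standardBorel
  have := measurableSet_range (fun h : T => s (h.1 0))
    (hs.comp ((measurable_pi_apply 0).comp measurable_subtype_coe)) (by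
      intro x
      have hc := Set.countable_pi (fun _ : Fin (n + 1) => hcount x)
      refine (hc.preimage (Subtype.val_injective (p := (· ∈ T)))).mono ?_
      intro h hh i
      exact (h.2.2 i).trans hh)
  convert this using 1
  ext x
  simp only [mem_ofPred_eq, mem_range, Subtype.exists]
  constructor
  · intro hx
    obtain ⟨t, hts, htc⟩ := Set.exists_subset_encard_eq hx
    have hfin : t.Finite := Set.finite_of_encard_eq_coe htc
    have hcard : Nat.card t = n + 1 := by
      rw [Nat.card_coe_set_eq, Set.ncard, htc]; rfl
    have := hfin.to_subtype
    let e := (Finite.equivFinOfCardEq hcard).symm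
    refine ⟨fun i => (e i).1, ⟨fun i j hij h => hij (e.injective (Subtype.ext h)), fun i => ?_⟩, ?_⟩
    · exact (hts (e i).2).trans (hts (e 0).2).symm
    · exact hts (e 0).2
  · rintro ⟨h, ⟨hi, hsame⟩, hx⟩
    have hinj : Function.Injective h := fun i j hij => by
      by_contra hne
      exact hi i j hne hij
    have : (range h).encard = ((n + 1 : ℕ) : ℕ∞) := by
      rw [← image_univ, hinj.encard_image]; simp
    rw [← this]
    apply Set.encard_le_encard
    rintro _ ⟨i, rfl⟩
    exact (hsame i).trans hx

end FiberCard

/-- If `s : Z → X` is a Borel countable-to-one map between standard Borel spaces, then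
for every `n ∈ ℕ` the set of points of `X` whose fiber has exactly `n` elements is
Borel. -/
theorem measurableSet_fiber_card_eq {Z X : Type*}
    [MeasurableSpace Z] [StandardBorelSpace Z] [MeasurableSpace X] [StandardBorelSpace X]
    (s : Z → X) (hs : Measurable s)
    (hcount : ∀ x : X, (s ⁻¹' {x}).Countable) (n : ℕ) :
    MeasurableSet {x : X | (s ⁻¹' {x}).encard = n} := by
  have h1 := FiberCard.measurableSet_le s hs hcount n
  have h2 := FiberCard.measurableSet_le s hs hcount (n + 1)
  convert h1.diff h2 using 1
  ext x
  simp only [mem_ofPred_eq, Set.mem_sdiff, not_le]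
  rw [Nat.cast_add, Nat.cast_one, ENat.lt_natCast_add_one_iff, le_antisymm_iff, and_comm]
end
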